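/- There exists a universal constant c > 0 such that, with K(y) = −(2c/F³)(y₁² + y₂² − 3y₃²/F²)/|y|_{1/F}⁶, for every Schwartz function f on ℝ³ and every x ∈ ℝ³ the integral ∫_{ℝ³} K(y)(f(x−y) + f(x+y) − 2f(x)) dy converges absolutely and Λf(x) = (1/2) ∫_{ℝ³} K(y)(f(x−y) + f(x+y) − 2f(x)) dy. -/

import Mathlib

open MeasureTheory
open scoped Real FourierTransform SchwartzMap

noncomputable section

/-- `|ξ|_F² = ξ₁² + ξ₂² + F²ξ₃²`. -/
def normFsq (F : ℝ) (ξ : EuclideanSpace ℝ (Fin 3)) : ℝ :=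
  ξ 0 ^ 2 + ξ 1 ^ 2 + F ^ 2 * ξ 2 ^ 2

/-- `|x|_{1/F}² = x₁² + x₂² + x₃²/F²`. -/
def normInvFsq (F : ℝ) (x : EuclideanSpace ℝ (Fin 3)) : ℝ :=
  x 0 ^ 2 + x 1 ^ 2 + x 2 ^ 2 / F ^ 2

/-- The operator `Λ = ∂₃²(−Δ_F)^{−1/2}`: the Fourier multiplier with symbol `−ξ₃²/|ξ|_F`. -/
def Lambda (F : ℝ) (f : EuclideanSpace ℝ (Fin 3) → ℂ) :
    EuclideanSpace ℝ (Fin 3) → ℂ :=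
  fun x => 𝓕⁻ (fun ξ => ((-(ξ 2 ^ 2) / Real.sqrt (normFsq F ξ) : ℝ) : ℂ) * 𝓕 f ξ) x

/-- The kernel `K(y) = −(2c/F³)(y₁² + y₂² − 3y₃²/F²)/|y|_{1/F}⁶`. -/
def Kker (c F : ℝ) (y : EuclideanSpace ℝ (Fin 3)) : ℝ :=
  -(2 * c / F ^ 3) * (y 0 ^ 2 + y 1 ^ 2 - 3 * y 2 ^ 2 / F ^ 2) / (normInvFsq F y) ^ 3

/-- The Fourier transform of a centred real Gaussian. -/
lemma integral_gaussian_mul_cexp {b : ℝ} (hb : 0 < b) (u : ℝ) :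
    ∫ s : ℝ, (Real.exp (-b * s ^ 2) : ℂ) * Complex.exp (Complex.I * u * s) =
      ((√(π / b) * Real.exp (-u ^ 2 / (4 * b)) : ℝ) : ℂ) := by
  have h := fourierIntegral_gaussian (b := (b : ℂ)) (by simpa using hb) (u : ℂ)
  have h2 : ((π : ℂ) / b) ^ (1 / 2 : ℂ) = ((√(π / b) : ℝ) : ℂ) := by
    rw [Real.sqrt_eq_rpow, Complex.ofReal_cpow (by positivity)]
    push_cast
    rfl
  rw [h2] at h
  push_cast
  rw [← h]
  exact integral_congr_ae (.of_forall fun s => mul_comm _ _)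

lemma norm_cexp_I_mul_mul (u s : ℝ) : ‖Complex.exp (Complex.I * u * s)‖ = 1 := by
  rw [show Complex.I * u * s = ((u * s : ℝ) : ℂ) * Complex.I by push_cast; ring,
    Complex.norm_exp_ofReal_mul_I]

lemma integrable_mul_cexp {g : ℝ → ℝ} (hg : Integrable g) (u : ℝ) :
    Integrable fun s : ℝ => (g s : ℂ) * Complex.exp (Complex.I * u * s) := by
  refine hg.ofReal.mul_bdd (c := 1) (by fun_prop) (.of_forall fun s => ?_)
  exact (norm_cexp_I_mul_mul u s).le

lemma integrable_sq_mul_exp_neg_mul_sq {b : ℝ} (hb : 0 < b) :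
    Integrable fun s : ℝ => s ^ 2 * Real.exp (-b * s ^ 2) := by
  simpa using integrable_rpow_mul_exp_neg_mul_sq hb (s := 2) (by norm_num)

lemma integrable_one_sub_sq_mul_exp {b : ℝ} (hb : 0 < b) :
    Integrable fun s : ℝ => (1 - 2 * b * s ^ 2) * Real.exp (-b * s ^ 2) := by
  convert (integrable_exp_neg_mul_sq hb).sub
    ((integrable_sq_mul_exp_neg_mul_sq hb).const_mul (2 * b)) using 2 with s
  simp only [Pi.sub_apply]
  ring

/-- The Fourier transform of `(1 - 2 b s²) exp (-b s²)`, obtained by integrating by parts twice. -/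
lemma integral_one_sub_sq_mul_gaussian_mul_cexp {b : ℝ} (hb : 0 < b) (u : ℝ) :
    ∫ s : ℝ, (((1 - 2 * b * s ^ 2) * Real.exp (-b * s ^ 2) : ℝ) : ℂ) *
        Complex.exp (Complex.I * u * s) =
      ((u ^ 2 / (2 * b) * (√(π / b) * Real.exp (-u ^ 2 / (4 * b))) : ℝ) : ℂ) := by
  have i0 := integrable_mul_cexp (integrable_exp_neg_mul_sq hb) u
  have i1 := integrable_mul_cexp (integrable_mul_exp_neg_mul_sq hb) u
  have i2 := integrable_mul_cexp (integrable_one_sub_sq_mul_exp hb) u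
  have hE (s : ℝ) : HasDerivAt (fun s : ℝ => Complex.exp (Complex.I * u * s))
      (Complex.exp (Complex.I * u * s) * (Complex.I * u)) s := by
    have := ((hasDerivAt_id s).ofReal_comp.const_mul (Complex.I * (u : ℂ))).cexp
    simpa using this
  have hG (s : ℝ) : HasDerivAt (fun s : ℝ => Real.exp (-b * s ^ 2))
      (Real.exp (-b * s ^ 2) * (-b * (2 * s))) s := by
    have := (((hasDerivAt_id s).pow 2).const_mul (-b)).exp
    simpa using this
  have d0 (s : ℝ) := (hG s).ofReal_comp.mul (hE s)
  have d1 (s : ℝ) := ((hasDerivAt_id s).mul (hG s)).ofReal_comp.mul (hE s)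
  have e0 := integral_eq_zero_of_hasDerivAt_of_integrable
    (f' := fun s : ℝ => (Complex.I * u) *
        ((Real.exp (-b * s ^ 2) : ℂ) * Complex.exp (Complex.I * u * s)) -
      (2 * b : ℂ) * (((s * Real.exp (-b * s ^ 2) : ℝ) : ℂ) * Complex.exp (Complex.I * u * s)))
    (fun s => (d0 s).congr_deriv (by push_cast; ring))
    ((i0.const_mul _).sub (i1.const_mul _)) i0
  have e1 := integral_eq_zero_of_hasDerivAt_of_integrable
    (f' := fun s : ℝ => (((1 - 2 * b * s ^ 2) * Real.exp (-b * s ^ 2) : ℝ) : ℂ) *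
        Complex.exp (Complex.I * u * s) +
      (Complex.I * u) *
        (((s * Real.exp (-b * s ^ 2) : ℝ) : ℂ) * Complex.exp (Complex.I * u * s)))
    (fun s => (d1 s).congr_deriv (by simp only [Pi.mul_apply, id]; push_cast; ring))
    (i2.add (i1.const_mul _)) i1
  rw [integral_sub (i0.const_mul _) (i1.const_mul _), integral_const_mul, integral_const_mul,
    integral_gaussian_mul_cexp hb] at e0
  rw [integral_add i2 (i1.const_mul _), integral_const_mul] at e1
  have hb' : (b : ℂ) ≠ 0 := by exact_mod_cast hb.ne'
  have e0' := eq_div_of_mul_eq (c := (2 * b : ℂ)) (mul_ne_zero two_ne_zero hb')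
    ((mul_comm _ _).trans (sub_eq_zero.1 e0).symm)
  rw [e0'] at e1
  rw [eq_neg_of_add_eq_zero_left e1]
  push_cast
  linear_combination (-(u : ℂ) ^ 2 / (2 * b) * (√(π / b) * Complex.exp (-u ^ 2 / (4 * b)))) *
    Complex.I_sq

/-- The kernel at scale `t` whose integral over `t > 0` is the homogeneous kernel of `Λ`. -/
def heatKer (F t : ℝ) (y : EuclideanSpace ℝ (Fin 3)) : ℝ :=
  (t - 2 * t ^ 2 * (y 2 ^ 2 / F ^ 2)) * Real.exp (-(t * normInvFsq F y))

lemma integrable_prod_coord {g : Fin 3 → ℝ → ℂ} (hg : ∀ i, Integrable (g i)) :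
    Integrable fun y : EuclideanSpace ℝ (Fin 3) => g 0 (y 0) * g 1 (y 1) * g 2 (y 2) := by
  have h := Integrable.fintype_prod (f := g) (μ := fun _ => volume) hg
  have := (PiLp.volume_preserving_ofLp (Fin 3)).integrable_comp h.aestronglyMeasurable
  simpa [Function.comp_def, Fin.prod_univ_three] using this.2 h

lemma integral_prod_coord (g : Fin 3 → ℝ → ℂ) :
    ∫ y : EuclideanSpace ℝ (Fin 3), g 0 (y 0) * g 1 (y 1) * g 2 (y 2) =
      (∫ s, g 0 s) * (∫ s, g 1 s) * ∫ s, g 2 s := by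
  have h := integral_fintype_prod_volume_eq_prod g
  rw [← (EuclideanSpace.volume_preserving_symm_measurableEquiv_toLp (Fin 3)).integral_comp'] at h
  simpa [Fin.prod_univ_three] using h

/-- The one-dimensional factors of `heatKer F t y * exp (2πi ⟨y, ξ⟩)`. -/
def heatFactor (F t : ℝ) (ξ : EuclideanSpace ℝ (Fin 3)) : Fin 3 → ℝ → ℂ :=
  ![fun s => t * ((Real.exp (-t * s ^ 2) : ℂ) * Complex.exp (Complex.I * (2 * π * ξ 0 : ℝ) * s)),
    fun s => (Real.exp (-t * s ^ 2) : ℂ) * Complex.exp (Complex.I * (2 * π * ξ 1 : ℝ) * s),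
    fun s => (((1 - 2 * (t / F ^ 2) * s ^ 2) * Real.exp (-(t / F ^ 2) * s ^ 2) : ℝ) : ℂ) *
      Complex.exp (Complex.I * (2 * π * ξ 2 : ℝ) * s)]

lemma heatFactor_prod (F t : ℝ) (ξ y : EuclideanSpace ℝ (Fin 3)) :
    heatFactor F t ξ 0 (y 0) * heatFactor F t ξ 1 (y 1) * heatFactor F t ξ 2 (y 2) =
      (heatKer F t y : ℂ) * Complex.exp ((2 * π * inner ℝ y ξ : ℝ) * Complex.I) := by
  have e1 : -(t * normInvFsq F y) = -t * y 0 ^ 2 + -t * y 1 ^ 2 + -(t / F ^ 2) * y 2 ^ 2 := by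
    unfold normInvFsq; ring
  have e2 : ((2 * π * inner ℝ y ξ : ℝ) : ℂ) * Complex.I =
      Complex.I * (2 * π * ξ 0 : ℝ) * (y 0 : ℝ) + Complex.I * (2 * π * ξ 1 : ℝ) * (y 1 : ℝ) +
        Complex.I * (2 * π * ξ 2 : ℝ) * (y 2 : ℝ) := by
    simp [PiLp.inner_apply, Fin.sum_univ_three]; ring
  rw [heatKer, e1, e2, Real.exp_add, Real.exp_add, Complex.exp_add, Complex.exp_add]
  simp only [heatFactor, Matrix.cons_val]
  push_cast
  ring

lemma integrable_heatFactor {F t : ℝ} (hF : 0 < F) (ht : 0 < t)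
    (ξ : EuclideanSpace ℝ (Fin 3)) (i : Fin 3) : Integrable (heatFactor F t ξ i) := by
  have hb : 0 < t / F ^ 2 := by positivity
  fin_cases i
  · exact (integrable_mul_cexp (integrable_exp_neg_mul_sq ht) _).const_mul _
  · exact integrable_mul_cexp (integrable_exp_neg_mul_sq ht) _
  · exact integrable_mul_cexp (integrable_one_sub_sq_mul_exp hb) _

lemma integrable_heatKer_mul_cexp {F t : ℝ} (hF : 0 < F) (ht : 0 < t)
    (ξ : EuclideanSpace ℝ (Fin 3)) : Integrable fun y : EuclideanSpace ℝ (Fin 3) =>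
      (heatKer F t y : ℂ) * Complex.exp ((2 * π * inner ℝ y ξ : ℝ) * Complex.I) := by
  simpa only [heatFactor_prod] using integrable_prod_coord (integrable_heatFactor hF ht ξ)

lemma integral_heatKer_mul_cexp {F t : ℝ} (hF : 0 < F) (ht : 0 < t)
    (ξ : EuclideanSpace ℝ (Fin 3)) :
    ∫ y : EuclideanSpace ℝ (Fin 3),
      (heatKer F t y : ℂ) * Complex.exp ((2 * π * inner ℝ y ξ : ℝ) * Complex.I) =
      ((2 * π ^ 2 * F ^ 3 * ξ 2 ^ 2 * ((π / t) * √(π / t)) *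
        Real.exp (-(π ^ 2 * normFsq F ξ / t)) : ℝ) : ℂ) := by
  have h := integral_prod_coord (heatFactor F t ξ)
  simp only [heatFactor_prod] at h
  have hb : 0 < t / F ^ 2 := by positivity
  rw [h]
  simp only [heatFactor, Matrix.cons_val]
  rw [integral_const_mul, integral_gaussian_mul_cexp ht, integral_gaussian_mul_cexp ht,
    integral_one_sub_sq_mul_gaussian_mul_cexp hb]
  have hs : √(π / (t / F ^ 2)) = √(π / t) * F := by
    rw [show π / (t / F ^ 2) = π / t * F ^ 2 by field_simp, Real.sqrt_mul (by positivity),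
      Real.sqrt_sq hF.le]
  have hs2 : √(π / t) * √(π / t) = π / t := Real.mul_self_sqrt (by positivity)
  have he : -(π ^ 2 * normFsq F ξ / t) = -(2 * π * ξ 0) ^ 2 / (4 * t) +
      -(2 * π * ξ 1) ^ 2 / (4 * t) + -(2 * π * ξ 2) ^ 2 / (4 * (t / F ^ 2)) := by
    unfold normFsq; field_simp; ring
  rw [hs, he, Real.exp_add, Real.exp_add]
  generalize √(π / t) = S at *
  rw [← hs2]
  norm_cast
  field_simp

lemma integral_heatKer_mul_cos_sub_one {F t : ℝ} (hF : 0 < F) (ht : 0 < t)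
    (ξ : EuclideanSpace ℝ (Fin 3)) :
    ∫ y : EuclideanSpace ℝ (Fin 3), heatKer F t y * (Real.cos (2 * π * inner ℝ y ξ) - 1) =
      2 * π ^ 2 * F ^ 3 * ξ 2 ^ 2 * ((π / t) * √(π / t)) *
        Real.exp (-(π ^ 2 * normFsq F ξ / t)) := by
  have i1 := integrable_heatKer_mul_cexp hF ht ξ
  have i0 := integrable_heatKer_mul_cexp hF ht 0
  have h1 := integral_heatKer_mul_cexp hF ht ξ
  have h0 := integral_heatKer_mul_cexp hF ht 0
  have h := (integral_re (i1.sub i0)).trans (congrArg Complex.re (integral_sub' i1 i0))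
  rw [h1, h0] at h
  convert h using 1
  · refine integral_congr_ae (.of_forall fun y => ?_)
    simp [-Complex.ofReal_mul, Complex.exp_ofReal_mul_I_re]
    ring
  · simp [-Complex.ofReal_mul]

lemma integrableOn_pow_mul_exp_neg_mul_Ioi (n : ℕ) {r : ℝ} (hr : 0 < r) :
    IntegrableOn (fun t : ℝ => t ^ n * Real.exp (-(t * r))) (Set.Ioi 0) ∧
      ∫ t in Set.Ioi (0 : ℝ), t ^ n * Real.exp (-(t * r)) = n.factorial / r ^ (n + 1) := by
  have h := Real.integral_rpow_mul_exp_neg_mul_Ioi (a := n + 1) (by positivity) hr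
  rw [Real.Gamma_nat_eq_factorial] at h
  have h2 : ∫ t in Set.Ioi (0 : ℝ), t ^ n * Real.exp (-(t * r)) = n.factorial / r ^ (n + 1) := by
    have e : (1 / r) ^ ((n : ℝ) + 1) * (n.factorial : ℝ) = n.factorial / r ^ (n + 1) := by
      rw [← Nat.cast_succ, Real.rpow_natCast, one_div, inv_pow]
      field_simp
    rw [← e, ← h]
    simp [mul_comm r]
  refine ⟨not_imp_comm.1 integral_undef ?_, h2⟩
  rw [h2]
  positivity

/-- `∫ (π/t)^{3/2} exp (-a/t) dt`, by the substitution `t ↦ 1/t`. -/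
lemma integral_div_mul_sqrt_mul_exp_neg_div {a : ℝ} (ha : 0 < a) :
    ∫ t in Set.Ioi (0 : ℝ), (π / t) * √(π / t) * Real.exp (-(a / t)) = π ^ 2 / √a := by
  have h := integral_comp_rpow_Ioi
    (fun s : ℝ => s ^ ((1 / 2 : ℝ) - 1) * Real.exp (-(a * s))) (p := -1) (by norm_num)
  rw [Real.integral_rpow_mul_exp_neg_mul_Ioi (by norm_num) ha, Real.Gamma_one_half_eq,
    ← Real.sqrt_eq_rpow] at h
  have e : π ^ 2 / √a = π * √π * (√(1 / a) * √π) := by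
    rw [Real.sqrt_div zero_le_one, Real.sqrt_one]
    linear_combination (-π / √a) * Real.mul_self_sqrt Real.pi_pos.le
  rw [e, ← h, ← integral_const_mul]
  refine setIntegral_congr_fun measurableSet_Ioi fun t (ht : 0 < t) => ?_
  have e1 : t ^ (-1 - 1 : ℝ) = (t ^ 2)⁻¹ := by
    rw [show (-1 - 1 : ℝ) = -(2 : ℕ) by norm_num, Real.rpow_neg ht.le, Real.rpow_natCast]
  have e2 : (t⁻¹) ^ ((1 / 2 : ℝ) - 1) = √t := by
    rw [show (1 / 2 : ℝ) - 1 = -(1 / 2) by norm_num, Real.inv_rpow ht.le, Real.rpow_neg ht.le,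
      inv_inv, Real.sqrt_eq_rpow]
  have hs : 0 < √t := Real.sqrt_pos.2 ht
  have hst : √t ^ 2 = t := Real.sq_sqrt ht.le
  simp only [Real.rpow_neg_one, e1, e2, smul_eq_mul, abs_neg, abs_one, one_mul]
  rw [Real.sqrt_div Real.pi_pos.le, div_eq_mul_inv a t]
  field_simp
  rw [hst]

lemma norm_sq_eq_sum_three (y : EuclideanSpace ℝ (Fin 3)) :
    ‖y‖ ^ 2 = y 0 ^ 2 + y 1 ^ 2 + y 2 ^ 2 := by
  simp [EuclideanSpace.norm_sq_eq, Fin.sum_univ_three]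

lemma norm_sq_le_normInvFsq {F : ℝ} (hF : F ∈ Set.Ioc (0 : ℝ) 1)
    (y : EuclideanSpace ℝ (Fin 3)) : ‖y‖ ^ 2 ≤ normInvFsq F y := by
  rw [norm_sq_eq_sum_three, normInvFsq]
  gcongr
  have := hF.1
  rw [le_div_iff₀ (by positivity)]
  exact mul_le_of_le_one_right (sq_nonneg _) (pow_le_one₀ hF.1.le hF.2)

lemma normInvFsq_pos {F : ℝ} (hF : F ∈ Set.Ioc (0 : ℝ) 1) {y : EuclideanSpace ℝ (Fin 3)}
    (hy : y ≠ 0) : 0 < normInvFsq F y :=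
  (pow_pos (norm_pos_iff.2 hy) 2).trans_le (norm_sq_le_normInvFsq hF y)

/-- An integrable majorant for the second-difference kernel. -/
def levyWeight (y : EuclideanSpace ℝ (Fin 3)) : ℝ := min 1 (‖y‖ ^ 2) / ‖y‖ ^ 4

lemma levyWeight_nonneg (y : EuclideanSpace ℝ (Fin 3)) : 0 ≤ levyWeight y := by
  unfold levyWeight; positivity

lemma integrable_levyWeight : Integrable levyWeight := by
  refine (integrable_fun_norm_addHaar (E := EuclideanSpace ℝ (Fin 3)) volume
    (f := fun r => min 1 (r ^ 2) / r ^ 4)).2 ?_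
  simp only [finrank_euclideanSpace_fin, smul_eq_mul]
  rw [← Set.Ioc_union_Ioi_eq_Ioi zero_le_one, integrableOn_union]
  constructor
  · refine (integrableOn_const (C := (1 : ℝ)) (by simp)).congr_fun (fun r hr => ?_)
      measurableSet_Ioc
    have h0 := hr.1
    have : r ^ 2 ≤ 1 := pow_le_one₀ hr.1.le hr.2
    simp only [min_eq_right this]
    field_simp
  · refine (integrableOn_Ioi_rpow_of_lt (a := -2) (by norm_num) zero_lt_one).congr_fun
      (fun r (hr : 1 < r) => ?_) measurableSet_Ioi
    have h0 : 0 < r := by linarith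
    have : 1 ≤ r ^ 2 := one_le_pow₀ hr.le
    simp only [min_eq_left this]
    rw [show (-2 : ℝ) = -(2 : ℕ) by norm_num, Real.rpow_neg h0.le, Real.rpow_natCast]
    field_simp

lemma abs_cos_inner_sub_one_le (y ξ : EuclideanSpace ℝ (Fin 3)) :
    |Real.cos (2 * π * inner ℝ y ξ) - 1| ≤ 2 * π ^ 2 * (1 + ‖ξ‖ ^ 2) * min 1 (‖y‖ ^ 2) := by
  have h1 := Real.one_sub_sq_div_two_le_cos (x := 2 * π * inner ℝ y ξ)
  have h2 := Real.cos_le_one (2 * π * inner ℝ y ξ)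
  have h3 := Real.neg_one_le_cos (2 * π * inner ℝ y ξ)
  have hπ : 1 ≤ π ^ 2 := one_le_pow₀ (by linarith [Real.pi_gt_three])
  have hi : inner ℝ y ξ ^ 2 ≤ (‖y‖ * ‖ξ‖) ^ 2 := sq_le_sq.2 (by
    rw [abs_of_nonneg (a := ‖y‖ * ‖ξ‖) (by positivity)]; exact abs_real_inner_le_norm y ξ)
  rw [abs_sub_comm, abs_of_nonneg (by linarith)]
  rcases min_cases 1 (‖y‖ ^ 2) with ⟨h, -⟩ | ⟨h, -⟩ <;> rw [h]
  · nlinarith [mul_nonneg (sq_nonneg π) (sq_nonneg ‖ξ‖)]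
  · nlinarith [mul_le_mul_of_nonneg_left hi (sq_nonneg π),
      mul_nonneg (sq_nonneg π) (sq_nonneg ‖y‖)]

lemma div_normInvFsq_sq_le {F : ℝ} (hF : F ∈ Set.Ioc (0 : ℝ) 1)
    (y ξ : EuclideanSpace ℝ (Fin 3)) :
    |Real.cos (2 * π * inner ℝ y ξ) - 1| * (5 / normInvFsq F y ^ 2) ≤
      10 * π ^ 2 * (1 + ‖ξ‖ ^ 2) * levyWeight y := by
  rcases eq_or_ne y 0 with rfl | hy
  · simp [levyWeight]
  have hy' := norm_pos_iff.2 hy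
  have h := norm_sq_le_normInvFsq hF y
  have h2 : 5 / normInvFsq F y ^ 2 ≤ 5 / ‖y‖ ^ 4 := by
    rw [show ‖y‖ ^ 4 = (‖y‖ ^ 2) ^ 2 by ring]
    gcongr
  calc _ ≤ _ := mul_le_mul (abs_cos_inner_sub_one_le y ξ) h2 (by positivity) (by positivity)
    _ = _ := by unfold levyWeight; ring

/-- The homogeneous kernel of degree `-4` underlying `Kker`. -/
def homKer (F : ℝ) (y : EuclideanSpace ℝ (Fin 3)) : ℝ :=
  (y 0 ^ 2 + y 1 ^ 2 - 3 * y 2 ^ 2 / F ^ 2) / normInvFsq F y ^ 3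

lemma Kker_eq (c F : ℝ) (y : EuclideanSpace ℝ (Fin 3)) :
    Kker c F y = -(2 * c / F ^ 3) * homKer F y := mul_div_assoc _ _ _

lemma abs_homKer_le {F : ℝ} (hF : F ∈ Set.Ioc (0 : ℝ) 1) (y : EuclideanSpace ℝ (Fin 3)) :
    |homKer F y| ≤ 5 / normInvFsq F y ^ 2 := by
  rcases eq_or_ne y 0 with rfl | hy
  · simp [homKer, normInvFsq]
  have hq := normInvFsq_pos hF hy
  have e : 5 / normInvFsq F y ^ 2 = 5 * normInvFsq F y / normInvFsq F y ^ 3 := by field_simp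
  rw [e, homKer, abs_div, abs_of_pos (pow_pos hq 3)]
  gcongr
  have h2 : 0 ≤ y 2 ^ 2 / F ^ 2 := by positivity
  rw [abs_le, normInvFsq, mul_div_assoc]
  constructor <;> nlinarith [sq_nonneg (y 0), sq_nonneg (y 1)]

lemma heatKer_eq (F t : ℝ) (y : EuclideanSpace ℝ (Fin 3)) :
    heatKer F t y = t ^ 1 * Real.exp (-(t * normInvFsq F y)) -
      2 * (y 2 ^ 2 / F ^ 2) * (t ^ 2 * Real.exp (-(t * normInvFsq F y))) := by
  unfold heatKer; ring

lemma integrableOn_heatKer {F : ℝ} (hF : F ∈ Set.Ioc (0 : ℝ) 1)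
    {y : EuclideanSpace ℝ (Fin 3)} (hy : y ≠ 0) :
    IntegrableOn (fun t => heatKer F t y) (Set.Ioi 0) := by
  have hq := normInvFsq_pos hF hy
  simp only [heatKer_eq]
  exact (integrableOn_pow_mul_exp_neg_mul_Ioi 1 hq).1.sub
    ((integrableOn_pow_mul_exp_neg_mul_Ioi 2 hq).1.const_mul _)

lemma integral_heatKer {F : ℝ} (hF : F ∈ Set.Ioc (0 : ℝ) 1)
    {y : EuclideanSpace ℝ (Fin 3)} (hy : y ≠ 0) :
    ∫ t in Set.Ioi (0 : ℝ), heatKer F t y = homKer F y := by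
  have hq := normInvFsq_pos hF hy
  have h1 := integrableOn_pow_mul_exp_neg_mul_Ioi 1 hq
  have h2 := integrableOn_pow_mul_exp_neg_mul_Ioi 2 hq
  simp only [heatKer_eq]
  rw [integral_sub h1.1 (h2.1.const_mul _), integral_const_mul, h1.2, h2.2]
  have e : y 0 ^ 2 + y 1 ^ 2 - 3 * y 2 ^ 2 / F ^ 2 =
      normInvFsq F y - 4 * (y 2 ^ 2 / F ^ 2) := by unfold normInvFsq; ring
  rw [homKer, e]
  norm_num [Nat.factorial]
  field_simp
  ring

lemma integral_abs_heatKer_le {F : ℝ} (hF : F ∈ Set.Ioc (0 : ℝ) 1)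
    {y : EuclideanSpace ℝ (Fin 3)} (hy : y ≠ 0) :
    ∫ t in Set.Ioi (0 : ℝ), |heatKer F t y| ≤ 5 / normInvFsq F y ^ 2 := by
  have hq := normInvFsq_pos hF hy
  have h1 := integrableOn_pow_mul_exp_neg_mul_Ioi 1 hq
  have h2 := integrableOn_pow_mul_exp_neg_mul_Ioi 2 hq
  have hle : y 2 ^ 2 / F ^ 2 ≤ normInvFsq F y := by
    unfold normInvFsq; linarith [sq_nonneg (y 0), sq_nonneg (y 1)]
  calc ∫ t in Set.Ioi (0 : ℝ), |heatKer F t y|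
      ≤ ∫ t in Set.Ioi (0 : ℝ), (t ^ 1 * Real.exp (-(t * normInvFsq F y)) +
          2 * (y 2 ^ 2 / F ^ 2) * (t ^ 2 * Real.exp (-(t * normInvFsq F y)))) := by
        refine setIntegral_mono_on (integrableOn_heatKer hF hy).abs
          (h1.1.add (h2.1.const_mul _)) measurableSet_Ioi fun t (ht : 0 < t) => ?_
        rw [heatKer_eq]
        refine (abs_sub _ _).trans_eq ?_
        rw [abs_of_nonneg (by positivity), abs_of_nonneg (by positivity)]
    _ = 1 / normInvFsq F y ^ 2 + 4 * (y 2 ^ 2 / F ^ 2) / normInvFsq F y ^ 3 := by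
        rw [integral_add h1.1 (h2.1.const_mul _), integral_const_mul, h1.2, h2.2]
        norm_num [Nat.factorial]
        ring
    _ ≤ 1 / normInvFsq F y ^ 2 + 4 * normInvFsq F y / normInvFsq F y ^ 3 := by gcongr
    _ = 5 / normInvFsq F y ^ 2 := by field_simp; ring

lemma integrable_heatKer_mul_cos_sub_one {F : ℝ} (hF : F ∈ Set.Ioc (0 : ℝ) 1)
    (ξ : EuclideanSpace ℝ (Fin 3)) :
    Integrable (Function.uncurry fun (y : EuclideanSpace ℝ (Fin 3)) (t : ℝ) =>
      heatKer F t y * (Real.cos (2 * π * inner ℝ y ξ) - 1))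
      (volume.prod (volume.restrict (Set.Ioi 0))) := by
  have hm : AEStronglyMeasurable (Function.uncurry fun (y : EuclideanSpace ℝ (Fin 3)) (t : ℝ) =>
      heatKer F t y * (Real.cos (2 * π * inner ℝ y ξ) - 1))
      (volume.prod (volume.restrict (Set.Ioi 0))) := by
    refine Continuous.aestronglyMeasurable ?_
    unfold heatKer normInvFsq Function.uncurry
    fun_prop
  refine (integrable_prod_iff hm).2 ⟨.of_forall fun y => ?_, ?_⟩
  · rcases eq_or_ne y 0 with rfl | hy
    · simp
    · exact (integrableOn_heatKer hF hy).mul_const (Real.cos (2 * π * inner ℝ y ξ) - 1)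
  · refine (integrable_levyWeight.const_mul (10 * π ^ 2 * (1 + ‖ξ‖ ^ 2))).mono'
      hm.norm.integral_prod_right' (.of_forall fun y => ?_)
    rw [Real.norm_of_nonneg (integral_nonneg fun _ => norm_nonneg _)]
    refine le_trans ?_ (div_normInvFsq_sq_le hF y ξ)
    simp only [Function.uncurry_apply_pair, norm_mul, Real.norm_eq_abs]
    rw [integral_mul_const, mul_comm]
    rcases eq_or_ne y 0 with rfl | hy
    · simp
    · gcongr
      exact integral_abs_heatKer_le hF hy

lemma integral_homKer_mul_cos_sub_one {F : ℝ} (hF : F ∈ Set.Ioc (0 : ℝ) 1)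
    (ξ : EuclideanSpace ℝ (Fin 3)) :
    ∫ y : EuclideanSpace ℝ (Fin 3), homKer F y * (Real.cos (2 * π * inner ℝ y ξ) - 1) =
      2 * π ^ 3 * F ^ 3 * (ξ 2 ^ 2 / √(normFsq F ξ)) := by
  have hF0 := hF.1
  calc _ = ∫ y : EuclideanSpace ℝ (Fin 3), ∫ t in Set.Ioi (0 : ℝ),
        heatKer F t y * (Real.cos (2 * π * inner ℝ y ξ) - 1) := by
        refine integral_congr_ae (.of_forall fun y => ?_)
        simp only
        rw [integral_mul_const]
        rcases eq_or_ne y 0 with rfl | hy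
        · simp
        · rw [integral_heatKer hF hy]
    _ = ∫ t in Set.Ioi (0 : ℝ), ∫ y : EuclideanSpace ℝ (Fin 3),
        heatKer F t y * (Real.cos (2 * π * inner ℝ y ξ) - 1) :=
        integral_integral_swap (integrable_heatKer_mul_cos_sub_one hF ξ)
    _ = ∫ t in Set.Ioi (0 : ℝ), 2 * π ^ 2 * F ^ 3 * ξ 2 ^ 2 *
        ((π / t) * √(π / t) * Real.exp (-(π ^ 2 * normFsq F ξ / t))) := by
        refine setIntegral_congr_fun measurableSet_Ioi fun t ht => ?_
        simp only
        rw [integral_heatKer_mul_cos_sub_one hF0 ht, mul_assoc]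
    _ = _ := by
        rw [integral_const_mul]
        rcases eq_or_ne (ξ 2) 0 with h | h
        · simp [h]
        · have hN : 0 < normFsq F ξ := by unfold normFsq; positivity
          rw [integral_div_mul_sqrt_mul_exp_neg_div (by positivity),
            Real.sqrt_mul (by positivity), Real.sqrt_sq Real.pi_pos.le]
          field_simp

lemma SchwartzMap.integrable_and_integral_cexp_mul_fourier (f : 𝓢(EuclideanSpace ℝ (Fin 3), ℂ))
    (z : EuclideanSpace ℝ (Fin 3)) :
    Integrable (fun ξ => Complex.exp ((2 * π * inner ℝ ξ z : ℝ) * Complex.I) * 𝓕 (⇑f) ξ) ∧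
      ∫ ξ, Complex.exp ((2 * π * inner ℝ ξ z : ℝ) * Complex.I) * 𝓕 (⇑f) ξ = f z := by
  have hg : Integrable (𝓕 (⇑f)) := by
    rw [← SchwartzMap.fourier_coe]
    exact SchwartzMap.integrable _
  constructor
  · refine hg.bdd_mul (c := 1) (by fun_prop) (.of_forall fun ξ => ?_)
    rw [Complex.norm_exp_ofReal_mul_I]
  · have h := congrFun (f.continuous.fourierInv_fourier_eq f.integrable hg) z
    rw [Real.fourierInv_eq'] at h
    simpa only [smul_eq_mul] using h

lemma SchwartzMap.integral_fourier_mul_cos_sub_one (f : 𝓢(EuclideanSpace ℝ (Fin 3), ℂ))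
    (x y : EuclideanSpace ℝ (Fin 3)) :
    ∫ ξ, ((2 * (Real.cos (2 * π * inner ℝ y ξ) - 1) : ℝ) : ℂ) *
        (Complex.exp ((2 * π * inner ℝ ξ x : ℝ) * Complex.I) * 𝓕 (⇑f) ξ) =
      f (x - y) + f (x + y) - 2 * f x := by
  obtain ⟨i1, h1⟩ := f.integrable_and_integral_cexp_mul_fourier (x - y)
  obtain ⟨i2, h2⟩ := f.integrable_and_integral_cexp_mul_fourier (x + y)
  obtain ⟨i3, h3⟩ := f.integrable_and_integral_cexp_mul_fourier x
  rw [← h1, ← h2, ← h3, ← integral_const_mul, ← integral_add' i1 i2,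
    ← integral_sub (i1.add i2) (i3.const_mul 2)]
  refine integral_congr_ae (.of_forall fun ξ => ?_)
  simp only [Pi.add_apply]
  have hsub : 2 * π * inner ℝ ξ (x - y) = 2 * π * inner ℝ ξ x + -(2 * π * inner ℝ y ξ) := by
    rw [inner_sub_right, real_inner_comm ξ y]; ring
  have hadd : 2 * π * inner ℝ ξ (x + y) = 2 * π * inner ℝ ξ x + 2 * π * inner ℝ y ξ := by
    rw [inner_add_right, real_inner_comm ξ y]; ring
  rw [hsub, hadd, Complex.ofReal_add, Complex.ofReal_add, Complex.ofReal_neg, add_mul, add_mul,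
    Complex.exp_add, Complex.exp_add]
  push_cast
  rw [Complex.cos]
  ring

lemma integrable_Kker_mul_cos_sub_one {F : ℝ} (hF : F ∈ Set.Ioc (0 : ℝ) 1) (c : ℝ)
    (f : 𝓢(EuclideanSpace ℝ (Fin 3), ℂ)) (x : EuclideanSpace ℝ (Fin 3)) :
    Integrable (Function.uncurry fun (y ξ : EuclideanSpace ℝ (Fin 3)) =>
      (Kker c F y : ℂ) * (((2 * (Real.cos (2 * π * inner ℝ y ξ) - 1) : ℝ) : ℂ) *
        (Complex.exp ((2 * π * inner ℝ ξ x : ℝ) * Complex.I) * 𝓕 (⇑f) ξ)))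
      (volume.prod volume) := by
  have hc : Continuous (𝓕 (⇑f)) := by
    rw [← SchwartzMap.fourier_coe]
    exact SchwartzMap.continuous _
  have hg : Integrable fun ξ => (1 + ‖ξ‖ ^ 2) * ‖𝓕 (⇑f) ξ‖ := by
    rw [← SchwartzMap.fourier_coe]
    refine (((𝓕 f).integrable_pow_mul volume 0).add
      ((𝓕 f).integrable_pow_mul volume 2)).congr (.of_forall fun ξ => ?_)
    simp only [Pi.add_apply]
    ring
  refine ((integrable_levyWeight.mul_prod hg).const_mul
    (|2 * c / F ^ 3| * (20 * π ^ 2))).mono' ?_ (.of_forall fun ⟨y, ξ⟩ => ?_)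
  · refine AEStronglyMeasurable.mul ?_ (Continuous.aestronglyMeasurable (by fun_prop))
    refine Measurable.aestronglyMeasurable ?_
    unfold Kker normInvFsq
    fun_prop
  · simp only [Function.uncurry_apply_pair, norm_mul, Complex.norm_real, Real.norm_eq_abs,
      Complex.norm_exp_ofReal_mul_I, one_mul, Kker_eq, abs_neg]
    have h := (mul_le_mul_of_nonneg_left (abs_homKer_le hF y) (abs_nonneg _)).trans
      (div_normInvFsq_sq_le hF y ξ)
    calc _ = (|2 * c / F ^ 3| * (2 * ‖𝓕 (⇑f) ξ‖)) *
          (|Real.cos (2 * π * inner ℝ y ξ) - 1| * |homKer F y|) := by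
          rw [abs_two]; ring
      _ ≤ _ := mul_le_mul_of_nonneg_left h (by positivity)
      _ = _ := by ring

/-- There is a universal constant `c > 0` such that for every `F ∈ (0,1]`, every Schwartz `f`
and every `x`, the second-difference singular integral converges absolutely and
`Λf(x) = (1/2) ∫ K(y)(f(x−y) + f(x+y) − 2f(x)) dy`. -/
theorem Lambda_singular_integral_representation :
    ∃ c > (0 : ℝ), ∀ F : ℝ, F ∈ Set.Ioc (0 : ℝ) 1 →
      ∀ f : 𝓢(EuclideanSpace ℝ (Fin 3), ℂ), ∀ x : EuclideanSpace ℝ (Fin 3),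
        Integrable (fun y : EuclideanSpace ℝ (Fin 3) =>
          ((Kker c F y : ℝ) : ℂ) * (f (x - y) + f (x + y) - 2 * f x)) volume ∧
        Lambda F ⇑f x =
          (1 / 2 : ℂ) *
            ∫ y : EuclideanSpace ℝ (Fin 3),
              ((Kker c F y : ℝ) : ℂ) * (f (x - y) + f (x + y) - 2 * f x) := by
  refine ⟨1 / (4 * π ^ 3), by positivity, fun F hF f x => ?_⟩
  have hF0 : F ≠ 0 := hF.1.ne'
  have hint := integrable_Kker_mul_cos_sub_one hF (1 / (4 * π ^ 3)) f x
  have hsecond (y : EuclideanSpace ℝ (Fin 3)) := f.integral_fourier_mul_cos_sub_one x y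
  have hy (y : EuclideanSpace ℝ (Fin 3)) :
      ∫ ξ, (Kker (1 / (4 * π ^ 3)) F y : ℂ) *
        (((2 * (Real.cos (2 * π * inner ℝ y ξ) - 1) : ℝ) : ℂ) *
        (Complex.exp ((2 * π * inner ℝ ξ x : ℝ) * Complex.I) * 𝓕 (⇑f) ξ)) =
      (Kker (1 / (4 * π ^ 3)) F y : ℂ) * (f (x - y) + f (x + y) - 2 * f x) := by
    rw [integral_const_mul, hsecond]
  refine ⟨by simpa only [Function.uncurry_apply_pair, hy] using hint.integral_prod_left, ?_⟩
  simp only [← hy]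
  rw [integral_integral_swap hint, Lambda, Real.fourierInv_eq', ← integral_const_mul]
  refine integral_congr_ae (.of_forall fun ξ => ?_)
  have e : ∫ y : EuclideanSpace ℝ (Fin 3), (Kker (1 / (4 * π ^ 3)) F y : ℂ) *
        (((2 * (Real.cos (2 * π * inner ℝ y ξ) - 1) : ℝ) : ℂ) *
        (Complex.exp ((2 * π * inner ℝ ξ x : ℝ) * Complex.I) * 𝓕 (⇑f) ξ)) =
      ((2 * (-(ξ 2 ^ 2) / √(normFsq F ξ)) : ℝ) : ℂ) *
        (Complex.exp ((2 * π * inner ℝ ξ x : ℝ) * Complex.I) * 𝓕 (⇑f) ξ) := by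
    simp only [← mul_assoc (Complex.ofReal (Kker _ _ _)), ← Complex.ofReal_mul (Kker _ _ _)]
    rw [integral_mul_const, integral_complex_ofReal]
    congr 2
    calc _ = ∫ y, -(2 * (1 / (4 * π ^ 3)) / F ^ 3) * 2 *
          (homKer F y * (Real.cos (2 * π * inner ℝ y ξ) - 1)) := by
          refine integral_congr_ae (.of_forall fun y => ?_)
          simp only [Kker_eq]
          ring
      _ = _ := by
          rw [integral_const_mul, integral_homKer_mul_cos_sub_one hF]
          field_simp
          ring
  simp only
  rw [e, smul_eq_mul]
  push_cast
  ring
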